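/- Let X be a nonempty finite set, let μ, σ : X → ℝ with σ(x) > 0 for all x ∈ X, and let y⋆ ∈ ℝ. Define γ(x) = (y⋆ − μ(x))/σ(x) and β^{1/2} = min_{x ∈ X} γ(x). Then for any x ∈ X the following are equivalent: (i) x minimizes γ over X; (ii) x maximizes μ(x) + β^{1/2}·σ(x) over X; (iii) x maximizes Ψ((μ(x) − y⋆)/σ(x)) over X. (That is, EST with m = y⋆, GP-UCB with β^{1/2} = min_x (y⋆ − μ(x))/σ(x), and PI with threshold θ = y⋆ select the same points.) -/

import Mathlib

open Real

/-- The standard normal probability density function. -/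
noncomputable def normalPdf (u : ℝ) : ℝ := (Real.sqrt (2 * Real.pi))⁻¹ * Real.exp (-u ^ 2 / 2)

/-- The standard normal cumulative distribution function. -/
noncomputable def normalCdf (u : ℝ) : ℝ := ∫ t in Set.Iic u, normalPdf t

lemma normalPdf_pos (u : ℝ) : 0 < normalPdf u := by
  unfold normalPdf
  positivity

lemma normalPdf_integrable : MeasureTheory.Integrable normalPdf := by
  have h := (integrable_exp_neg_mul_sq (b := 1 / 2) (by norm_num)).const_mul
    ((Real.sqrt (2 * Real.pi))⁻¹)
  refine h.congr (Filter.Eventually.of_forall fun u => ?_)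
  show _ = normalPdf u
  unfold normalPdf
  ring_nf

lemma normalCdf_strictMono : StrictMono normalCdf := by
  intro a b hab
  have h := intervalIntegral.integral_Iic_sub_Iic (f := normalPdf) (a := a) (b := b)
    (μ := MeasureTheory.volume)
    normalPdf_integrable.integrableOn normalPdf_integrable.integrableOn
  have h2 : 0 < ∫ t in a..b, normalPdf t :=
    intervalIntegral.intervalIntegral_pos_of_pos
      normalPdf_integrable.intervalIntegrable normalPdf_pos hab
  unfold normalCdf
  linarith

/-- EST with `m = y⋆`, GP-UCB with `β^{1/2} = min_x (y⋆ − μ(x))/σ(x)`, and PI with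
threshold `θ = y⋆` select the same points. -/
theorem est_ucb_pi_equivalent {X : Type*} [Fintype X] [Nonempty X]
    (μ σ : X → ℝ) (hσ : ∀ x, 0 < σ x) (ystar : ℝ)
    (γ : X → ℝ) (hγ : ∀ x, γ x = (ystar - μ x) / σ x)
    (β : ℝ) (hβ : β = Finset.univ.inf' Finset.univ_nonempty γ) (x : X) :
    ((∀ x' : X, γ x ≤ γ x') ↔ (∀ x' : X, μ x' + β * σ x' ≤ μ x + β * σ x)) ∧
    ((∀ x' : X, γ x ≤ γ x') ↔
      (∀ x' : X, normalCdf ((μ x' - ystar) / σ x') ≤ normalCdf ((μ x - ystar) / σ x))) := by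
  have hle : ∀ z, β ≤ γ z := fun z => hβ ▸ Finset.inf'_le γ (Finset.mem_univ z)
  have hμ : ∀ z, μ z + β * σ z = ystar - (γ z - β) * σ z := by
    intro z
    have := (hσ z).ne'
    rw [hγ z]
    field_simp
    ring
  obtain ⟨z, -, hz⟩ := Finset.exists_mem_eq_inf' Finset.univ_nonempty γ
  rw [← hβ] at hz
  refine ⟨⟨fun h x' => ?_, fun h x' => ?_⟩, ?_⟩
  · have hx : γ x = β := le_antisymm (hz ▸ h z) (hle x)
    rw [hμ, hμ, hx]
    have := mul_nonneg (sub_nonneg.2 (hle x')) (hσ x').le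
    linarith
  · have h1 := h z
    rw [hμ, hμ, ← hz] at h1
    refine le_trans ?_ (hle x')
    by_contra hc
    push Not at hc
    have := mul_pos (sub_pos.2 hc) (hσ x)
    linarith
  · refine forall_congr' fun x' => ?_
    rw [normalCdf_strictMono.le_iff_le, hγ, hγ, ← neg_sub ystar, ← neg_sub ystar, neg_div, neg_div,
      neg_le_neg_iff]
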